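/- Sort uniqueness: if both logical typings Γ ⊢ A : s and Γ ⊢ A : t are derivable for sorts s and t, then s = t. -/

import Mathlib

namespace TLL

/-- The two sorts of TLL: `U` (non-linear) and `L` (linear). -/
inductive Srt : Type
  | U | L
deriving DecidableEq

/-- TLL terms in de Bruijn representation: variables, sorts, the two Π-type
formers (irrelevant `pi0` and relevant `pi1`), the two λ-formers, application,
the erased constant `box`, and heap pointers `ptr`. -/
inductive Tm : Type
  | var  : Nat → Tm
  | srt  : Srt → Tm
  | pi0  : Srt → Tm → Tm → Tm
  | pi1  : Srt → Tm → Tm → Tm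
  | lam0 : Srt → Tm → Tm → Tm
  | lam1 : Srt → Tm → Tm → Tm
  | app  : Tm → Tm → Tm
  | box  : Tm
  | ptr  : Nat → Tm

def upr (ξ : Nat → Nat) : Nat → Nat
  | 0 => 0
  | n + 1 => ξ n + 1

def rename (ξ : Nat → Nat) : Tm → Tm
  | .var x => .var (ξ x)
  | .srt s => .srt s
  | .pi0 t A B => .pi0 t (rename ξ A) (rename (upr ξ) B)
  | .pi1 t A B => .pi1 t (rename ξ A) (rename (upr ξ) B)
  | .lam0 t A m => .lam0 t (rename ξ A) (rename (upr ξ) m)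
  | .lam1 t A m => .lam1 t (rename ξ A) (rename (upr ξ) m)
  | .app m n => .app (rename ξ m) (rename ξ n)
  | .box => .box
  | .ptr l => .ptr l

def up (σ : Nat → Tm) : Nat → Tm
  | 0 => .var 0
  | n + 1 => rename Nat.succ (σ n)

def subst (σ : Nat → Tm) : Tm → Tm
  | .var x => σ x
  | .srt s => .srt s
  | .pi0 t A B => .pi0 t (subst σ A) (subst (up σ) B)
  | .pi1 t A B => .pi1 t (subst σ A) (subst (up σ) B)
  | .lam0 t A m => .lam0 t (subst σ A) (subst (up σ) m)
  | .lam1 t A m => .lam1 t (subst σ A) (subst (up σ) m)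
  | .app m n => .app (subst σ m) (subst σ n)
  | .box => .box
  | .ptr l => .ptr l

/-- `subst1 n m` is `m[n/x]` for the topmost bound variable `x`. -/
def subst1 (n : Tm) (m : Tm) : Tm :=
  subst (fun i => match i with | 0 => n | i + 1 => .var i) m

/-- Logical one-step reduction `m ~> n`: full β-reduction with both β-rules,
closed under all structural subterm positions. -/
inductive LStep : Tm → Tm → Prop
  | beta0 {t A m n} : LStep (.app (.lam0 t A m) n) (subst1 n m)
  | beta1 {t A m n} : LStep (.app (.lam1 t A m) n) (subst1 n m)
  | appL {m m' n} : LStep m m' → LStep (.app m n) (.app m' n)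
  | appR {m n n'} : LStep n n' → LStep (.app m n) (.app m n')
  | pi0A {t A A' B} : LStep A A' → LStep (.pi0 t A B) (.pi0 t A' B)
  | pi0B {t A B B'} : LStep B B' → LStep (.pi0 t A B) (.pi0 t A B')
  | pi1A {t A A' B} : LStep A A' → LStep (.pi1 t A B) (.pi1 t A' B)
  | pi1B {t A B B'} : LStep B B' → LStep (.pi1 t A B) (.pi1 t A B')
  | lam0A {t A A' m} : LStep A A' → LStep (.lam0 t A m) (.lam0 t A' m)
  | lam0M {t A m m'} : LStep m m' → LStep (.lam0 t A m) (.lam0 t A m')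
  | lam1A {t A A' m} : LStep A A' → LStep (.lam1 t A m) (.lam1 t A' m)
  | lam1M {t A m m'} : LStep m m' → LStep (.lam1 t A m) (.lam1 t A m')

/-- Multi-step logical reduction. -/
abbrev LRed : Tm → Tm → Prop := Relation.ReflTransGen LStep

/-- Definitional equality `A ≃ B`: equivalence closure of logical reduction. -/
def Conv (A B : Tm) : Prop := Relation.EqvGen LStep A B

/-- Parallel logical reduction `m ⇒ n`. -/
inductive PStep : Tm → Tm → Prop
  | var {x} : PStep (.var x) (.var x)
  | srt {s} : PStep (.srt s) (.srt s)
  | box : PStep .box .box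
  | ptr {l} : PStep (.ptr l) (.ptr l)
  | pi0 {t A A' B B'} : PStep A A' → PStep B B' → PStep (.pi0 t A B) (.pi0 t A' B')
  | pi1 {t A A' B B'} : PStep A A' → PStep B B' → PStep (.pi1 t A B) (.pi1 t A' B')
  | lam0 {t A A' m m'} : PStep A A' → PStep m m' → PStep (.lam0 t A m) (.lam0 t A' m')
  | lam1 {t A A' m m'} : PStep A A' → PStep m m' → PStep (.lam1 t A m) (.lam1 t A' m')
  | app {m m' n n'} : PStep m m' → PStep n n' → PStep (.app m n) (.app m' n')
  | beta0 {t A m m' n n'} : PStep m m' → PStep n n' →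
      PStep (.app (.lam0 t A m) n) (subst1 n' m')
  | beta1 {t A m m' n n'} : PStep m m' → PStep n n' →
      PStep (.app (.lam1 t A m) n) (subst1 n' m')

/-- Logical contexts: lists of types (de Bruijn). -/
abbrev Ctx := List Tm

/-- `Has Γ x A`: variable `x` has type `A` in logical context `Γ`
(with the appropriate de Bruijn shifts). -/
inductive Has : Ctx → Nat → Tm → Prop
  | zero {Γ A} : Has (A :: Γ) 0 (rename Nat.succ A)
  | succ {Γ x A B} : Has Γ x A → Has (B :: Γ) (x + 1) (rename Nat.succ A)

mutual
/-- Well-formed logical contexts. -/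
inductive LWf : Ctx → Prop
  | nil : LWf []
  | cons {Γ A s} : LWf Γ → LTyped Γ A (.srt s) → LWf (A :: Γ)

/-- The logical typing judgment `Γ ⊢ m : A`. -/
inductive LTyped : Ctx → Tm → Tm → Prop
  | srt {Γ} (s : Srt) : LWf Γ → LTyped Γ (.srt s) (.srt .U)
  | var {Γ x A} : LWf Γ → Has Γ x A → LTyped Γ (.var x) A
  | pi0 {Γ A B s r} (t : Srt) :
      LTyped Γ A (.srt s) → LTyped (A :: Γ) B (.srt r) →
      LTyped Γ (.pi0 t A B) (.srt t)
  | pi1 {Γ A B s r} (t : Srt) :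
      LTyped Γ A (.srt s) → LTyped (A :: Γ) B (.srt r) →
      LTyped Γ (.pi1 t A B) (.srt t)
  | lam0 {Γ A B m} (t : Srt) :
      LTyped (A :: Γ) m B → LTyped Γ (.lam0 t A m) (.pi0 t A B)
  | lam1 {Γ A B m} (t : Srt) :
      LTyped (A :: Γ) m B → LTyped Γ (.lam1 t A m) (.pi1 t A B)
  | app0 {Γ m n A B t} :
      LTyped Γ m (.pi0 t A B) → LTyped Γ n A → LTyped Γ (.app m n) (subst1 n B)
  | app1 {Γ m n A B t} :
      LTyped Γ m (.pi1 t A B) → LTyped Γ n A → LTyped Γ (.app m n) (subst1 n B)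
  | conv {Γ m A B s} :
      LTyped Γ m A → LTyped Γ B (.srt s) → Conv A B → LTyped Γ m B
end

/-- Program context entries: either absent, or a sort-annotated type. -/
abbrev Entry := Option (Srt × Tm)

/-- Program contexts, positionally aligned with the logical context. -/
abbrev PCtx := List Entry

/-- The context constraint `Δ ▷ s`. -/
inductive Restr : PCtx → Srt → Prop
  | nil {s} : Restr [] s
  | skip {Δ s} : Restr Δ s → Restr ((none : Entry) :: Δ) s
  | u {Δ A} : Restr Δ .U → Restr (some (.U, A) :: Δ) .U
  | l {Δ s A} : Restr Δ .L → Restr (some (s, A) :: Δ) .L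

/-- Context merge `Δ₁ ∪̇ Δ₂ = Δ`: contraction on shared `U` entries,
`L` entries occur on exactly one side. -/
inductive Merge : PCtx → PCtx → PCtx → Prop
  | nil : Merge [] [] []
  | contra {Δ₁ Δ₂ Δ A} : Merge Δ₁ Δ₂ Δ →
      Merge (some (.U, A) :: Δ₁) (some (.U, A) :: Δ₂) (some (.U, A) :: Δ)
  | left {Δ₁ Δ₂ Δ A} : Merge Δ₁ Δ₂ Δ →
      Merge (some (.L, A) :: Δ₁) ((none : Entry) :: Δ₂) (some (.L, A) :: Δ)
  | right {Δ₁ Δ₂ Δ A} : Merge Δ₁ Δ₂ Δ →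
      Merge ((none : Entry) :: Δ₁) (some (.L, A) :: Δ₂) (some (.L, A) :: Δ)
  | skip {Δ₁ Δ₂ Δ} : Merge Δ₁ Δ₂ Δ →
      Merge ((none : Entry) :: Δ₁) ((none : Entry) :: Δ₂) ((none : Entry) :: Δ)

/-- `PHas Δ x s A`: the entry `x :s A` occurs in `Δ` and the rest of `Δ`
satisfies `▷ U` (so no linear entry is discarded). -/
inductive PHas : PCtx → Nat → Srt → Tm → Prop
  | zero {Δ s A} : Restr Δ .U → PHas (some (s, A) :: Δ) 0 s (rename Nat.succ A)
  | succN {Δ x s A} : PHas Δ x s A → PHas ((none : Entry) :: Δ) (x + 1) s (rename Nat.succ A)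
  | succU {Δ x s A B} : PHas Δ x s A → PHas (some (.U, B) :: Δ) (x + 1) s (rename Nat.succ A)

/-- Well-formed pairs of logical and program contexts `Γ ; Δ ⊢`. -/
inductive PWf : Ctx → PCtx → Prop
  | nil : PWf [] []
  | cons {Γ Δ A s} : PWf Γ Δ → LTyped Γ A (.srt s) → PWf (A :: Γ) (some (s, A) :: Δ)
  | consN {Γ Δ A s} : PWf Γ Δ → LTyped Γ A (.srt s) → PWf (A :: Γ) ((none : Entry) :: Δ)

/-- The program typing judgment `Γ ; Δ ⊢ m : A`. -/
inductive PTyped : Ctx → PCtx → Tm → Tm → Prop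
  | var {Γ Δ x s A} : PWf Γ Δ → PHas Δ x s A → PTyped Γ Δ (.var x) A
  | lam0 {Γ Δ A B m} (t : Srt) :
      PTyped (A :: Γ) ((none : Entry) :: Δ) m B → Restr Δ t →
      PTyped Γ Δ (.lam0 t A m) (.pi0 t A B)
  | lam1 {Γ Δ A B m s} (t : Srt) :
      PTyped (A :: Γ) (some (s, A) :: Δ) m B → Restr Δ t →
      PTyped Γ Δ (.lam1 t A m) (.pi1 t A B)
  | app0 {Γ Δ m n A B t} :
      PTyped Γ Δ m (.pi0 t A B) → LTyped Γ n A →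
      PTyped Γ Δ (.app m n) (subst1 n B)
  | app1 {Γ Δ₁ Δ₂ Δ m n A B t} :
      PTyped Γ Δ₁ m (.pi1 t A B) → PTyped Γ Δ₂ n A → Merge Δ₁ Δ₂ Δ →
      PTyped Γ Δ (.app m n) (subst1 n B)
  | conv {Γ Δ m A B s} :
      PTyped Γ Δ m A → LTyped Γ B (.srt s) → Conv A B →
      PTyped Γ Δ m B

/-- Program values. -/
inductive Value : Tm → Prop
  | var {x} : Value (.var x)
  | lam0 {t A m} : Value (.lam0 t A m)
  | lam1 {t A m} : Value (.lam1 t A m)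

/-- Program (call-by-value) one-step reduction `m ~~> n`. -/
inductive CStep : Tm → Tm → Prop
  | appL {m m' n} : CStep m m' → CStep (.app m n) (.app m' n)
  | appR {m n n'} : CStep n n' → CStep (.app m n) (.app m n')
  | beta0 {t A m n} : CStep (.app (.lam0 t A m) n) (subst1 n m)
  | beta1 {t A m v} : Value v → CStep (.app (.lam1 t A m) v) (subst1 v m)

/-- The erasure judgment `Γ ; Δ ⊢ m ~ m' : A`. -/
inductive Erase : Ctx → PCtx → Tm → Tm → Tm → Prop
  | var {Γ Δ x s A} : PWf Γ Δ → PHas Δ x s A → Erase Γ Δ (.var x) (.var x) A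
  | lam0 {Γ Δ A B m m'} (t : Srt) :
      Erase (A :: Γ) ((none : Entry) :: Δ) m m' B → Restr Δ t →
      Erase Γ Δ (.lam0 t A m) (.lam0 t .box m') (.pi0 t A B)
  | lam1 {Γ Δ A B m m' s} (t : Srt) :
      Erase (A :: Γ) (some (s, A) :: Δ) m m' B → Restr Δ t →
      Erase Γ Δ (.lam1 t A m) (.lam1 t .box m') (.pi1 t A B)
  | app0 {Γ Δ m m' n A B t} :
      Erase Γ Δ m m' (.pi0 t A B) → LTyped Γ n A →
      Erase Γ Δ (.app m n) (.app m' .box) (subst1 n B)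
  | app1 {Γ Δ₁ Δ₂ Δ m m' n n' A B t} :
      Erase Γ Δ₁ m m' (.pi1 t A B) → Erase Γ Δ₂ n n' A → Merge Δ₁ Δ₂ Δ →
      Erase Γ Δ (.app m n) (.app m' n') (subst1 n B)
  | conv {Γ Δ m m' A B s} :
      Erase Γ Δ m m' A → LTyped Γ B (.srt s) → Conv A B →
      Erase Γ Δ m m' B

/-- Heaps: finite maps from locations to sort-annotated values. -/
abbrev Heap := Nat → Option (Srt × Tm)

/-- Heap lookup `Lookup H₁ l v H₂`: non-linear cells persist, linear cells
are deallocated. -/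
inductive Lookup : Heap → Nat → Tm → Heap → Prop
  | u {H l v} : H l = some (.U, v) → Lookup H l v H
  | l {H l v} : H l = some (.L, v) → Lookup H l v (Function.update H l none)

/-- Heap merge `H₁ ∪̇ H₂ = H`. -/
def HMerge (H₁ H₂ H : Heap) : Prop := ∀ l,
  (H₁ l = none ∧ H₂ l = none ∧ H l = none) ∨
  (∃ v, H₁ l = some (.U, v) ∧ H₂ l = some (.U, v) ∧ H l = some (.U, v)) ∨
  (∃ v, H₁ l = some (.L, v) ∧ H₂ l = none ∧ H l = some (.L, v)) ∨
  (∃ v, H₁ l = none ∧ H₂ l = some (.L, v) ∧ H l = some (.L, v))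

/-- The heap constraint `H ▷ s`. -/
def HRestr (H : Heap) : Srt → Prop
  | .U => ∀ l s v, H l = some (s, v) → s = Srt.U
  | .L => True

/-- Heap reduction `H ; m ~~> H' ; m'`. -/
inductive HStep : Heap → Tm → Heap → Tm → Prop
  | alloc0 {H l t m} : H l = none →
      HStep H (.lam0 t .box m) (Function.update H l (some (t, .lam0 t .box m))) (.ptr l)
  | alloc1 {H l t m} : H l = none →
      HStep H (.lam1 t .box m) (Function.update H l (some (t, .lam1 t .box m))) (.ptr l)
  | appL {H H' m m' n} : HStep H m H' m' → HStep H (.app m n) H' (.app m' n)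
  | appR {H H' m n n'} : HStep H n H' n' → HStep H (.app m n) H' (.app m n')
  | beta0 {H H' l t m n} : Lookup H l (.lam0 t .box m) H' →
      HStep H (.app (.ptr l) n) H' (subst1 .box m)
  | beta1 {H H' l₁ l₂ t m} : Lookup H l₁ (.lam1 t .box m) H' →
      HStep H (.app (.ptr l₁) (.ptr l₂)) H' (subst1 (.ptr l₂) m)

/-- Pointer resolution `H ; m ~ n`. -/
inductive Resolve : Heap → Tm → Tm → Prop
  | var {H x} : HRestr H .U → Resolve H (.var x) (.var x)
  | lam0 {H t m' m} : HRestr H t → Resolve H m' m →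
      Resolve H (.lam0 t .box m') (.lam0 t .box m)
  | lam1 {H t m' m} : HRestr H t → Resolve H m' m →
      Resolve H (.lam1 t .box m') (.lam1 t .box m)
  | app0 {H m' m} : Resolve H m' m → Resolve H (.app m' .box) (.app m .box)
  | app1 {H₁ H₂ H m' m n' n} : HMerge H₁ H₂ H →
      Resolve H₁ m' m → Resolve H₂ n' n → Resolve H (.app m' n') (.app m n)
  | ptr {H H' l v' v} : Lookup H l v' H' → Resolve H' v' v → Resolve H (.ptr l) v

/-- `ClosedUnder k m`: all free de Bruijn variables of `m` are `< k`. -/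
def ClosedUnder : Nat → Tm → Prop
  | k, .var x => x < k
  | _, .srt _ => True
  | k, .pi0 _ A B => ClosedUnder k A ∧ ClosedUnder (k + 1) B
  | k, .pi1 _ A B => ClosedUnder k A ∧ ClosedUnder (k + 1) B
  | k, .lam0 _ A m => ClosedUnder k A ∧ ClosedUnder (k + 1) m
  | k, .lam1 _ A m => ClosedUnder k A ∧ ClosedUnder (k + 1) m
  | k, .app m n => ClosedUnder k m ∧ ClosedUnder k n
  | _, .box => True
  | _, .ptr _ => True

/-- WR-heaps: heaps plausibly produced by heap reduction. -/
inductive WrHeap : Heap → Prop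
  | nil : WrHeap (fun _ => none)
  | lam0 {H l t m} : ClosedUnder 1 m → WrHeap H → H l = none →
      WrHeap (Function.update H l (some (t, .lam0 t .box m)))
  | lam1 {H l t m} : ClosedUnder 1 m → WrHeap H → H l = none →
      WrHeap (Function.update H l (some (t, .lam1 t .box m)))

/-- Well-resolved `H ⊢ a ~ b ~ c : A`. -/
def WellResolved (H : Heap) (a b c A : Tm) : Prop :=
  Erase [] [] a b A ∧ Resolve H c b


theorem upr_comp (ξ ζ : Nat → Nat) : upr ζ ∘ upr ξ = upr (ζ ∘ ξ) := by
  funext x; cases x <;> rfl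

theorem up_comp_upr (ξ : Nat → Nat) (σ : Nat → Tm) : up σ ∘ upr ξ = up (σ ∘ ξ) := by
  funext x; cases x <;> rfl

theorem up_var : up Tm.var = Tm.var := by
  funext x; cases x <;> rfl

theorem rename_rename (m : Tm) (ξ ζ : Nat → Nat) :
    rename ζ (rename ξ m) = rename (ζ ∘ ξ) m := by
  induction m generalizing ξ ζ <;> simp_all [rename, upr_comp]

theorem subst_rename (m : Tm) (ξ : Nat → Nat) (σ : Nat → Tm) :
    subst σ (rename ξ m) = subst (σ ∘ ξ) m := by
  induction m generalizing ξ σ <;> simp_all [rename, subst, up_comp_upr]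

theorem rename_comp_up (ξ : Nat → Nat) (σ : Nat → Tm) :
    rename (upr ξ) ∘ up σ = up (rename ξ ∘ σ) := by
  funext x
  cases x with
  | zero => rfl
  | succ x => simp only [Function.comp, up, rename_rename]; rfl

theorem rename_subst (m : Tm) (ξ : Nat → Nat) (σ : Nat → Tm) :
    rename ξ (subst σ m) = subst (rename ξ ∘ σ) m := by
  induction m generalizing ξ σ <;> simp_all [rename, subst, rename_comp_up]

theorem subst_comp_up (σ τ : Nat → Tm) :
    subst (up τ) ∘ up σ = up (subst τ ∘ σ) := by
  funext x
  cases x with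
  | zero => rfl
  | succ x => simp only [Function.comp, up, subst_rename, rename_subst]; rfl

theorem subst_subst (m : Tm) (σ τ : Nat → Tm) :
    subst τ (subst σ m) = subst (subst τ ∘ σ) m := by
  induction m generalizing σ τ <;> simp_all [subst, subst_comp_up]

theorem subst_var (m : Tm) : subst Tm.var m = m := by
  induction m <;> simp_all [subst, up_var]

theorem rename_subst1 (ξ : Nat → Nat) (n m : Tm) :
    rename ξ (subst1 n m) = subst1 (rename ξ n) (rename (upr ξ) m) := by
  simp only [subst1, rename_subst, subst_rename]
  congr 1
  funext x; cases x <;> rfl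

theorem subst_subst1 (σ : Nat → Tm) (n m : Tm) :
    subst σ (subst1 n m) = subst1 (subst σ n) (subst (up σ) m) := by
  simp only [subst1, subst_subst]
  congr 1
  funext x
  cases x with
  | zero => rfl
  | succ x => simp only [Function.comp, up, subst_rename, subst]; exact (subst_var _).symm

theorem PStep.refl (m : Tm) : PStep m m := by
  induction m <;> constructor <;> assumption

theorem PStep.rename {m m' : Tm} (h : PStep m m') (ξ : Nat → Nat) :
    PStep (rename ξ m) (rename ξ m') := by
  induction h generalizing ξ with
  | beta0 _ _ ihm ihn => rw [rename_subst1]; exact .beta0 (ihm _) (ihn _)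
  | beta1 _ _ ihm ihn => rw [rename_subst1]; exact .beta1 (ihm _) (ihn _)
  | _ => constructor <;> apply_assumption

theorem PStep.up {σ τ : Nat → Tm} (h : ∀ x, PStep (σ x) (τ x)) (x : Nat) :
    PStep (up σ x) (up τ x) := by
  cases x with
  | zero => exact .var
  | succ x => exact (h x).rename _

theorem PStep.subst {m m' : Tm} (h : PStep m m') {σ τ : Nat → Tm}
    (hσ : ∀ x, PStep (σ x) (τ x)) : PStep (subst σ m) (subst τ m') := by
  induction h generalizing σ τ with
  | var => exact hσ _
  | srt => exact .srt
  | box => exact .box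
  | ptr => exact .ptr
  | pi0 _ _ ihA ihB => exact .pi0 (ihA hσ) (ihB (PStep.up hσ))
  | pi1 _ _ ihA ihB => exact .pi1 (ihA hσ) (ihB (PStep.up hσ))
  | lam0 _ _ ihA ihm => exact .lam0 (ihA hσ) (ihm (PStep.up hσ))
  | lam1 _ _ ihA ihm => exact .lam1 (ihA hσ) (ihm (PStep.up hσ))
  | app _ _ ihm ihn => exact .app (ihm hσ) (ihn hσ)
  | beta0 _ _ ihm ihn => rw [subst_subst1]; exact .beta0 (ihm (PStep.up hσ)) (ihn hσ)
  | beta1 _ _ ihm ihn => rw [subst_subst1]; exact .beta1 (ihm (PStep.up hσ)) (ihn hσ)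

theorem PStep.subst1 {m m' n n' : Tm} (hn : PStep n n') (hm : PStep m m') :
    PStep (subst1 n m) (subst1 n' m') :=
  hm.subst fun x => by
    cases x with
    | zero => exact hn
    | succ x => exact .var

/-- The complete development of a term: all its β-redexes contracted at once. -/
def dev : Tm → Tm
  | .pi0 t A B => .pi0 t (dev A) (dev B)
  | .pi1 t A B => .pi1 t (dev A) (dev B)
  | .lam0 t A m => .lam0 t (dev A) (dev m)
  | .lam1 t A m => .lam1 t (dev A) (dev m)
  | .app (.lam0 _ _ m) n => subst1 (dev n) (dev m)
  | .app (.lam1 _ _ m) n => subst1 (dev n) (dev m)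
  | .app m n => .app (dev m) (dev n)
  | m => m

theorem PStep.triangle {m n : Tm} (h : PStep m n) : PStep n (dev m) := by
  induction h with
  | var => exact .var
  | srt => exact .srt
  | box => exact .box
  | ptr => exact .ptr
  | pi0 _ _ ihA ihB => exact .pi0 ihA ihB
  | pi1 _ _ ihA ihB => exact .pi1 ihA ihB
  | lam0 _ _ ihA ihm => exact .lam0 ihA ihm
  | lam1 _ _ ihA ihm => exact .lam1 ihA ihm
  | beta0 _ _ ihm ihn => exact PStep.subst1 ihn ihm
  | beta1 _ _ ihm ihn => exact PStep.subst1 ihn ihm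
  | @app m _ _ _ hm _ ihm ihn =>
    cases m with
    | lam0 =>
      cases hm
      cases ihm with
      | lam0 _ ihb => exact .beta0 ihb ihn
    | lam1 =>
      cases hm
      cases ihm with
      | lam1 _ ihb => exact .beta1 ihb ihn
    | _ => exact .app ihm ihn

theorem LStep.pstep {m n : Tm} (h : LStep m n) : PStep m n := by
  induction h with
  | beta0 => exact .beta0 (.refl _) (.refl _)
  | beta1 => exact .beta1 (.refl _) (.refl _)
  | _ => constructor <;> first | assumption | exact .refl _

/-- Multi-step parallel reduction. -/
abbrev PRed : Tm → Tm → Prop := Relation.ReflTransGen PStep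

/-- Two terms are joinable when they have a common parallel reduct. -/
abbrev Joinable : Tm → Tm → Prop := Relation.Join PRed

theorem joinable_equivalence : Equivalence Joinable :=
  Relation.equivalence_join_reflTransGen fun _ _ _ hb hc =>
    ⟨_, .single hb.triangle, .single hc.triangle⟩

theorem Conv.joinable {A B : Tm} (h : Conv A B) : Joinable A B := by
  induction h with
  | rel _ _ h => exact ⟨_, .single h.pstep, .refl⟩
  | refl => exact joinable_equivalence.refl _
  | symm _ _ _ ih => exact joinable_equivalence.symm ih
  | trans _ _ _ _ _ ih₁ ih₂ => exact joinable_equivalence.trans ih₁ ih₂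

theorem Joinable.map {f : Tm → Tm} (hf : ∀ {a b}, PStep a b → PStep (f a) (f b)) {A B : Tm}
    (h : Joinable A B) : Joinable (f A) (f B) :=
  let ⟨C, hA, hB⟩ := h
  ⟨f C, hA.lift f fun _ _ => hf, hB.lift f fun _ _ => hf⟩

theorem PRed.srt_inv {s : Srt} {C : Tm} (h : PRed (.srt s) C) : C = .srt s := by
  induction h with
  | refl => rfl
  | tail _ h ih => subst ih; cases h; rfl

theorem PRed.pi0_inv {t : Srt} {A B C : Tm} (h : PRed (.pi0 t A B) C) :
    ∃ A' B', C = .pi0 t A' B' ∧ PRed B B' := by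
  induction h with
  | refl => exact ⟨_, _, rfl, .refl⟩
  | tail _ h ih =>
    obtain ⟨_, _, rfl, hB⟩ := ih
    cases h with
    | pi0 _ h => exact ⟨_, _, rfl, hB.tail h⟩

theorem PRed.pi1_inv {t : Srt} {A B C : Tm} (h : PRed (.pi1 t A B) C) :
    ∃ A' B', C = .pi1 t A' B' ∧ PRed B B' := by
  induction h with
  | refl => exact ⟨_, _, rfl, .refl⟩
  | tail _ h ih =>
    obtain ⟨_, _, rfl, hB⟩ := ih
    cases h with
    | pi1 _ h => exact ⟨_, _, rfl, hB.tail h⟩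

theorem Joinable.srt_inj {s t : Srt} (h : Joinable (.srt s) (.srt t)) : s = t := by
  obtain ⟨C, h₁, h₂⟩ := h
  exact Tm.srt.inj (h₁.srt_inv.symm.trans h₂.srt_inv)

theorem Joinable.pi0_inj {t t' : Srt} {A A' B B' : Tm}
    (h : Joinable (.pi0 t A B) (.pi0 t' A' B')) : Joinable B B' := by
  obtain ⟨C, h₁, h₂⟩ := h
  obtain ⟨_, _, rfl, hB⟩ := h₁.pi0_inv
  obtain ⟨_, _, he, hB'⟩ := h₂.pi0_inv
  cases he
  exact ⟨_, hB, hB'⟩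

theorem Joinable.pi1_inj {t t' : Srt} {A A' B B' : Tm}
    (h : Joinable (.pi1 t A B) (.pi1 t' A' B')) : Joinable B B' := by
  obtain ⟨C, h₁, h₂⟩ := h
  obtain ⟨_, _, rfl, hB⟩ := h₁.pi1_inv
  obtain ⟨_, _, he, hB'⟩ := h₂.pi1_inv
  cases he
  exact ⟨_, hB, hB'⟩

theorem not_joinable_pi0_pi1 {t t' : Srt} {A A' B B' : Tm} :
    ¬ Joinable (.pi0 t A B) (.pi1 t' A' B') := by
  rintro ⟨C, h₁, h₂⟩
  obtain ⟨_, _, rfl, _⟩ := h₁.pi0_inv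
  obtain ⟨_, _, he, _⟩ := h₂.pi1_inv
  cases he

/-- `Principal Γ m A`: the type `A` is given to `m` by a syntax-directed typing rule,
that is, without a final use of the conversion rule. -/
inductive Principal (Γ : Ctx) : Tm → Tm → Prop
  | srt {s} : Principal Γ (.srt s) (.srt .U)
  | var {x A} : Has Γ x A → Principal Γ (.var x) A
  | pi0 {t A B} : Principal Γ (.pi0 t A B) (.srt t)
  | pi1 {t A B} : Principal Γ (.pi1 t A B) (.srt t)
  | lam0 {t A B m} : LTyped (A :: Γ) m B → Principal Γ (.lam0 t A m) (.pi0 t A B)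
  | lam1 {t A B m} : LTyped (A :: Γ) m B → Principal Γ (.lam1 t A m) (.pi1 t A B)
  | app0 {m n A B t} : LTyped Γ m (.pi0 t A B) → Principal Γ (.app m n) (subst1 n B)
  | app1 {m n A B t} : LTyped Γ m (.pi1 t A B) → Principal Γ (.app m n) (subst1 n B)

theorem LTyped.principal {Γ : Ctx} {m C : Tm} : LTyped Γ m C →
    ∃ A, Principal Γ m A ∧ Joinable A C
  | .srt _ _ => ⟨_, .srt, joinable_equivalence.refl _⟩
  | .var _ h => ⟨_, .var h, joinable_equivalence.refl _⟩
  | .pi0 _ _ _ => ⟨_, .pi0, joinable_equivalence.refl _⟩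
  | .pi1 _ _ _ => ⟨_, .pi1, joinable_equivalence.refl _⟩
  | .lam0 _ h => ⟨_, .lam0 h, joinable_equivalence.refl _⟩
  | .lam1 _ h => ⟨_, .lam1 h, joinable_equivalence.refl _⟩
  | .app0 h _ => ⟨_, .app0 h, joinable_equivalence.refl _⟩
  | .app1 h _ => ⟨_, .app1 h, joinable_equivalence.refl _⟩
  | .conv h _ hc =>
    let ⟨A, hA, hj⟩ := h.principal
    ⟨A, hA, joinable_equivalence.trans hj hc.joinable⟩

theorem Has.unique {Γ : Ctx} {x : Nat} {A B : Tm} (hA : Has Γ x A) (hB : Has Γ x B) :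
    A = B := by
  induction hA generalizing B with
  | zero => cases hB; rfl
  | succ _ ih => cases hB with | succ h => rw [ih h]

/-- The types of a term are unique up to joinability. -/
theorem LTyped.unique {Γ : Ctx} {m A B : Tm} (hA : LTyped Γ m A) (hB : LTyped Γ m B) :
    Joinable A B := by
  induction m generalizing Γ A B
  all_goals
    obtain ⟨A', hA', hAj⟩ := hA.principal
    obtain ⟨B', hB', hBj⟩ := hB.principal
    refine joinable_equivalence.trans (joinable_equivalence.symm hAj)
      (joinable_equivalence.trans ?_ hBj)
    cases hA' <;> cases hB'
  case srt.srt.srt | pi0.pi0.pi0 | pi1.pi1.pi1 => exact joinable_equivalence.refl _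
  case var.var.var h₁ h₂ => rw [h₁.unique h₂]; exact joinable_equivalence.refl _
  case lam0.lam0.lam0 ih _ h₁ _ h₂ => exact (ih h₁ h₂).map fun h => .pi0 (.refl _) h
  case lam1.lam1.lam1 ih _ h₁ _ h₂ => exact (ih h₁ h₂).map fun h => .pi1 (.refl _) h
  case app.app0.app0 ih _ _ _ _ h₁ _ _ _ h₂ =>
    exact (ih h₁ h₂).pi0_inj.map (PStep.subst1 (.refl _))
  case app.app1.app1 ih _ _ _ _ h₁ _ _ _ h₂ =>
    exact (ih h₁ h₂).pi1_inj.map (PStep.subst1 (.refl _))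
  case app.app0.app1 ih _ _ _ _ h₁ _ _ _ h₂ => exact (not_joinable_pi0_pi1 (ih h₁ h₂)).elim
  case app.app1.app0 ih _ _ _ _ h₁ _ _ _ h₂ => exact (not_joinable_pi0_pi1 (ih h₂ h₁)).elim

/-- Sort uniqueness. -/
theorem sort_uniqueness {Γ : Ctx} {A : Tm} {s t : Srt}
    (h₁ : LTyped Γ A (.srt s)) (h₂ : LTyped Γ A (.srt t)) :
    s = t := by
  exact (h₁.unique h₂).srt_inj
end TLL
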